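/- Let G = (V,E) be an infinite, connected, locally finite graph with a specified vertex o, let (X_t)_{t≥0} be simple random walk on G started at o with t-step transition probabilities p_t(·,·), and let p ∈ (0,1). Assume: (1) there exists ℓ > 0 such that almost surely lim_{t→∞} d(X_0, X_t)/t = ℓ (positive asymptotic speed); (2) there exists h > 0 such that lim_{t→∞} H(X_t)/t = h, where H(X_t) = −Σ_x p_t(o,x)·log p_t(o,x) (positive Avez entropy); (3) almost surely lim_{t→∞} (1/t)·log p_t(o, X_t) = −h (Shannon's theorem holds). Then N_p(G, B_n, δ_o) = exp(n·(h/ℓ)·(1+o(1))); that is, for every ε > 0 there exists n₀ such that for all n ≥ n₀, exp(n·(h/ℓ)·(1−ε)) ≤ N_p(G, B_n, δ_o) ≤ exp(n·(h/ℓ)·(1+ε)). -/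

import Mathlib

open scoped Classical ENNReal

noncomputable section

variable {V : Type*}

/-- A mass distribution: a nonnegative, finitely supported function on the vertices. -/
def IsMassDist (μ : V → ℝ) : Prop :=
  (∀ v, 0 ≤ μ v) ∧ (Function.support μ).Finite

/-- The unit point mass at a vertex `o`. -/
def pointMass (o : V) : V → ℝ := fun u => if u = o then 1 else 0

/-- The result of toppling mass `m` at the vertex `v`: remove mass `m` from `v` and
distribute it equally among the neighbors of `v`. -/
def topple (G : SimpleGraph V) [G.LocallyFinite] (μ : V → ℝ) (v : V) (m : ℝ) : V → ℝ :=
  fun u => μ u - (if u = v then m else 0) + (if G.Adj v u then m / (G.degree v : ℝ) else 0)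

/-- `ToppleSeq G μ₀ t μ₁` : there is a sequence of `t` valid toppling moves
taking `μ₀` to `μ₁`. -/
def ToppleSeq (G : SimpleGraph V) [G.LocallyFinite] (μ₀ : V → ℝ) (t : ℕ) (μ₁ : V → ℝ) : Prop :=
  ∃ μs : ℕ → V → ℝ, μs 0 = μ₀ ∧ μs t = μ₁ ∧
    ∀ i < t, ∃ v m, 0 < m ∧ m ≤ μs i v ∧ μs (i + 1) = topple G (μs i) v m

/-- `CanTransport G A p μ₀ t` : starting from `μ₀` there are `t` toppling moves after which
the total mass outside of `A` is at least `p`. -/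
def CanTransport (G : SimpleGraph V) [G.LocallyFinite] (A : Set V) (p : ℝ)
    (μ₀ : V → ℝ) (t : ℕ) : Prop :=
  ∃ μ₁ : V → ℝ, ToppleSeq G μ₀ t μ₁ ∧ p ≤ ∑' v : {v : V // v ∉ A}, μ₁ v

/-- The open ball of radius `n` around `o` in the graph distance. -/
def gball (G : SimpleGraph V) (o : V) (n : ℕ) : Set V := {u | G.dist o u < n}


/-- `rwKernel G k x y` is the `k`-step transition probability of simple random walk on `G`
(at each step the walk moves to a uniformly random neighbor of its current vertex). -/
def rwKernel (G : SimpleGraph V) [G.LocallyFinite] : ℕ → V → V → ℝ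
  | 0 => fun x y => if x = y then 1 else 0
  | (k + 1) => fun x y => ∑ z ∈ G.neighborFinset x, ((G.degree x : ℝ))⁻¹ * rwKernel G k z y

/-- `IsSRW G o P X` : under the probability measure `P`, the process `X` is a simple random walk
on `G` started at `o`. This is expressed via the finite-dimensional distributions: for every `k`
and every prospective trajectory `v`, the probability that the walk follows `v` up to time `k`
equals the product of the one-step transition probabilities (starting from `o`). -/
def IsSRW {Ω : Type*} [MeasurableSpace Ω] (G : SimpleGraph V) [G.LocallyFinite] (o : V)
    (P : MeasureTheory.Measure Ω) (X : ℕ → Ω → V) : Prop :=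
  ∀ (k : ℕ) (v : ℕ → V),
    P {ω | ∀ j ≤ k, X j ω = v j} =
      (if v 0 = o then 1 else 0) *
        ∏ j ∈ Finset.range k,
          (if G.Adj (v j) (v (j + 1)) then ((G.degree (v j) : ℝ≥0∞))⁻¹ else 0)

namespace CD

lemma countable_of_connected (G : SimpleGraph V) [G.LocallyFinite] (hc : G.Connected) (o : V) :
    Countable V := by
  let S : ℕ → Set V := fun n => Nat.rec {o} (fun _ s => ⋃ x ∈ s, (G.neighborSet x)) n
  have hS : ∀ n, (S n).Countable := by
    intro n
    induction n with
    | zero => exact Set.countable_singleton o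
    | succ n ih =>
      exact ih.biUnion fun x _ => (Set.toFinite (G.neighborSet x)).countable
  have hw : ∀ (u v : V) (w : G.Walk u v) (n : ℕ), u ∈ S n → ∃ m, v ∈ S m := by
    intro u v w
    induction w with
    | nil => exact fun n h => ⟨n, h⟩
    | @cons a b c hab _ ih =>
      intro n h
      exact ih (n + 1) (Set.mem_biUnion h hab)
  have hU : (⋃ n, S n) = Set.univ := by
    ext v
    obtain ⟨w⟩ := hc.preconnected o v
    obtain ⟨m, hm⟩ := hw o v w 0 rfl
    simp only [Set.mem_iUnion, Set.mem_univ, iff_true]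
    exact ⟨m, hm⟩
  exact Set.countable_univ_iff.mp (hU ▸ Set.countable_iUnion hS)

/-- averaging operator -/
def avg (G : SimpleGraph V) [G.LocallyFinite] (f : V → ℝ) (x : V) : ℝ :=
  ∑ z ∈ G.neighborFinset x, ((G.degree x : ℝ))⁻¹ * f z

variable (G : SimpleGraph V) [G.LocallyFinite]

lemma avg_mono {f g : V → ℝ} (h : ∀ x, f x ≤ g x) (x : V) : avg G f x ≤ avg G g x :=
  Finset.sum_le_sum fun z _ => mul_le_mul_of_nonneg_left (h z) (by positivity)

lemma avg_nonneg {f : V → ℝ} (h : ∀ x, 0 ≤ f x) (x : V) : 0 ≤ avg G f x :=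
  Finset.sum_nonneg fun z _ => mul_nonneg (by positivity) (h z)

lemma avg_add (f g : V → ℝ) (x : V) :
    avg G (fun y => f y + g y) x = avg G f x + avg G g x := by
  simp [avg, mul_add, Finset.sum_add_distrib]

lemma avg_one_le (x : V) : avg G (fun _ => 1) x ≤ 1 := by
  simp only [avg, mul_one, Finset.sum_const, SimpleGraph.card_neighborFinset_eq_degree,
    nsmul_eq_mul]
  exact mul_inv_le_one

lemma avg_le_one {f : V → ℝ} (h : ∀ x, f x ≤ 1) (x : V) : avg G f x ≤ 1 :=
  (avg_mono G h x).trans (avg_one_le G x)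

lemma avg_one (hd : ∀ x, 0 < G.degree x) (x : V) : avg G (fun _ => 1) x = 1 := by
  simp only [avg, mul_one, Finset.sum_const, SimpleGraph.card_neighborFinset_eq_degree,
    nsmul_eq_mul]
  exact mul_inv_cancel₀ (by exact_mod_cast (hd x).ne')

lemma rw_nonneg (k : ℕ) (x y : V) : 0 ≤ rwKernel G k x y := by
  induction k generalizing x with
  | zero => simp only [rwKernel]; split_ifs <;> norm_num
  | succ k ih => exact avg_nonneg G (f := fun z => rwKernel G k z y) ih x

/-- probability that the walk started from `x` is in `A i` at each time `i ≤ m` -/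
def pathProb : (ℕ → Set V) → ℕ → V → ℝ
  | A, 0 => fun x => if x ∈ A 0 then 1 else 0
  | A, (m + 1) => fun x => if x ∈ A 0 then avg G (pathProb (fun i => A (i + 1)) m) x else 0

lemma pathProb_nonneg (A : ℕ → Set V) (m : ℕ) (x : V) : 0 ≤ pathProb G A m x := by
  induction m generalizing A x with
  | zero => simp only [pathProb]; split_ifs <;> norm_num
  | succ m ih =>
    simp only [pathProb]; split_ifs
    · exact avg_nonneg G (ih _) x
    · rfl

lemma pathProb_le_one (A : ℕ → Set V) (m : ℕ) (x : V) : pathProb G A m x ≤ 1 := by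
  induction m generalizing A x with
  | zero => simp only [pathProb]; split_ifs <;> norm_num
  | succ m ih =>
    simp only [pathProb]; split_ifs
    · exact avg_le_one G (ih _) x
    · norm_num

lemma pathProb_inter (hd : ∀ x, 0 < G.degree x) (A C : ℕ → Set V) (m : ℕ) (x : V) :
    pathProb G A m x + pathProb G C m x ≤ pathProb G (fun i => A i ∩ C i) m x + 1 := by
  induction m generalizing A C x with
  | zero =>
    simp only [pathProb, Set.mem_inter_iff]
    by_cases h1 : x ∈ A 0 <;> by_cases h2 : x ∈ C 0 <;> simp [h1, h2]
  | succ m ih =>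
    have h1 := pathProb_le_one G A (m + 1) x
    have h2 := pathProb_le_one G C (m + 1) x
    by_cases hA : x ∈ A 0
    · by_cases hC : x ∈ C 0
      · simp only [pathProb, Set.mem_inter_iff, hA, hC, and_self, if_true]
        have := avg_mono G (ih (fun i => A (i + 1)) (fun i => C (i + 1))) x
        rw [avg_add, avg_add, avg_one G hd] at this
        exact this
      · simp only [pathProb, Set.mem_inter_iff, hA, hC, and_false, if_false, if_true] at h1 h2 ⊢
        linarith
    · simp only [pathProb, Set.mem_inter_iff, hA, false_and, if_false] at h1 h2 ⊢
      linarith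

lemma pathProb_add_sum (A : ℕ → Set V) (m : ℕ) (x : V) (S : Finset V)
    (hS : ∀ y ∈ S, y ∉ A m) :
    pathProb G A m x + ∑ y ∈ S, rwKernel G m x y ≤ 1 := by
  induction m generalizing A x with
  | zero =>
    simp only [pathProb, rwKernel, Finset.sum_ite_eq]
    by_cases h1 : x ∈ S
    · simp [h1, hS x h1]
    · simp only [h1, if_false]; split_ifs <;> norm_num
  | succ m ih =>
    have h := avg_le_one G (ih (fun i => A (i + 1)) · hS) x
    rw [avg_add] at h
    have e : avg G (fun y => ∑ i ∈ S, rwKernel G m y i) x = ∑ y ∈ S, rwKernel G (m+1) x y := by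
      simp only [avg, rwKernel, Finset.mul_sum]
      exact Finset.sum_comm
    rw [e] at h
    simp only [pathProb]
    split_ifs
    · exact h
    · have := avg_nonneg G (pathProb_nonneg G (fun i => A (i + 1)) m) x
      linarith

lemma sum_rw_le_one (m : ℕ) (x : V) (S : Finset V) : ∑ y ∈ S, rwKernel G m x y ≤ 1 := by
  have := pathProb_add_sum G (fun _ => ∅) m x S (by simp)
  linarith [pathProb_nonneg G (fun _ => ∅) m x]

section prob
open MeasureTheory
variable {Ω : Type*} [MeasurableSpace Ω] {P : Measure Ω} {X : ℕ → Ω → V} {o : V}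

lemma prob_cylinder [Countable V] (hX : IsSRW G o P X) (m : ℕ) (A : ℕ → Set V) (k : ℕ) (v : ℕ → V) :
    P {ω | (∀ j ≤ k, X j ω = v j) ∧ ∀ i ≤ m, X (k + i) ω ∈ A i} ≤
      P {ω | ∀ j ≤ k, X j ω = v j} * ENNReal.ofReal (pathProb G A m (v k)) := by
  induction m generalizing A k v with
  | zero =>
    by_cases h : v k ∈ A 0
    · simp only [pathProb, h, if_true, ENNReal.ofReal_one, mul_one]
      exact measure_mono fun ω hω => hω.1
    · have : {ω | (∀ j ≤ k, X j ω = v j) ∧ ∀ i ≤ 0, X (k + i) ω ∈ A i} = ∅ := by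
        ext ω
        simp only [Set.mem_ofPred_eq, Set.mem_empty_iff_false, iff_false, not_and]
        intro h1 h2
        have := h2 0 le_rfl
        rw [add_zero, h1 k le_rfl] at this
        exact h this
      rw [this]; simp
  | succ m ih =>
    by_cases h : v k ∈ A 0
    · have hsub : {ω | (∀ j ≤ k, X j ω = v j) ∧ ∀ i ≤ m + 1, X (k + i) ω ∈ A i} ⊆
          ⋃ z : V, {ω | (∀ j ≤ k + 1, X j ω = Function.update v (k + 1) z j) ∧
            ∀ i ≤ m, X (k + 1 + i) ω ∈ A (i + 1)} := by
        rintro ω ⟨h1, h2⟩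
        refine Set.mem_iUnion.mpr ⟨X (k + 1) ω, ?_, ?_⟩
        · intro j hj
          rcases Nat.lt_or_ge k j with h3 | h3
          · obtain rfl : j = k + 1 := by omega
            simp
          · rw [Function.update_of_ne (by omega), h1 j h3]
        · intro i hi
          have := h2 (i + 1) (by omega)
          rwa [show k + 1 + i = k + (i + 1) by ring]
      refine (measure_mono hsub).trans ((measure_iUnion_le _).trans ?_)
      have hz : ∀ z : V, P {ω | (∀ j ≤ k + 1, X j ω = Function.update v (k + 1) z j) ∧
            ∀ i ≤ m, X (k + 1 + i) ω ∈ A (i + 1)} ≤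
          P {ω | ∀ j ≤ k, X j ω = v j} * ((if G.Adj (v k) z then ((G.degree (v k) : ℝ≥0∞))⁻¹ else 0)
            * ENNReal.ofReal (pathProb G (fun i => A (i + 1)) m z)) := by
        intro z
        refine (ih (fun i => A (i + 1)) (k + 1) (Function.update v (k + 1) z)).trans (le_of_eq ?_)
        rw [hX, hX, Finset.prod_range_succ]
        simp only [Function.update_self]
        rw [Function.update_of_ne (by omega : (0 : ℕ) ≠ k + 1),
          Function.update_of_ne (by omega : k ≠ k + 1)]
        have : ∀ j ∈ Finset.range k, (if G.Adj (Function.update v (k + 1) z j)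
            (Function.update v (k + 1) z (j + 1)) then
              ((G.degree (Function.update v (k + 1) z j) : ℝ≥0∞))⁻¹ else 0) =
            (if G.Adj (v j) (v (j + 1)) then ((G.degree (v j) : ℝ≥0∞))⁻¹ else 0) := by
          intro j hj
          rw [Finset.mem_range] at hj
          rw [Function.update_of_ne (by omega : j ≠ k + 1),
            Function.update_of_ne (by omega : j + 1 ≠ k + 1)]
        rw [Finset.prod_congr rfl this]
        ring
      refine (ENNReal.tsum_le_tsum hz).trans ?_
      rw [ENNReal.tsum_mul_left]
      gcongr
      rw [tsum_eq_sum (s := G.neighborFinset (v k))]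
      · simp only [pathProb, h, if_true, avg]
        rw [ENNReal.ofReal_sum_of_nonneg
          (fun z _ => mul_nonneg (by positivity) (pathProb_nonneg G _ _ _))]
        refine Finset.sum_le_sum fun z hz => ?_
        rw [SimpleGraph.mem_neighborFinset] at hz
        have hpos : 0 < G.degree (v k) := (G.degree_pos_iff_exists_adj _).mpr ⟨z, hz⟩
        rw [if_pos hz, ENNReal.ofReal_mul (by positivity),
          ENNReal.ofReal_inv_of_pos (by exact_mod_cast hpos), ENNReal.ofReal_natCast]
      · intro z hz
        rw [SimpleGraph.mem_neighborFinset] at hz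
        simp [hz]
    · have : {ω | (∀ j ≤ k, X j ω = v j) ∧ ∀ i ≤ m + 1, X (k + i) ω ∈ A i} = ∅ := by
        ext ω
        simp only [Set.mem_ofPred_eq, Set.mem_empty_iff_false, iff_false, not_and]
        intro h1 h2
        have := h2 0 (by omega)
        rw [add_zero, h1 k le_rfl] at this
        exact h this
      rw [this]; simp

lemma ae_start [Countable V] (hX : IsSRW G o P X) : P {ω | X 0 ω ≠ o} = 0 := by
  have hsub : {ω | X 0 ω ≠ o} ⊆ ⋃ z : {z : V // z ≠ o}, {ω | ∀ j ≤ 0, X j ω = z.1} := by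
    intro ω hω
    refine Set.mem_iUnion.mpr ⟨⟨X 0 ω, hω⟩, ?_⟩
    intro j hj
    obtain rfl : j = 0 := by omega
    rfl
  refine measure_mono_null hsub (measure_iUnion_null fun z => ?_)
  have := hX 0 (fun _ => z.1)
  rw [this]
  simp [z.2]

lemma prob_le_pathProb [Countable V] [IsProbabilityMeasure P]
    (hX : IsSRW G o P X) (m : ℕ) (A : ℕ → Set V) :
    P {ω | ∀ i ≤ m, X i ω ∈ A i} ≤ ENNReal.ofReal (pathProb G A m o) := by
  have h := prob_cylinder G hX m A 0 (fun _ => o)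
  have hsub : {ω | ∀ i ≤ m, X i ω ∈ A i} ⊆
      {ω | (∀ j ≤ 0, X j ω = o) ∧ ∀ i ≤ m, X (0 + i) ω ∈ A i} ∪ {ω | X 0 ω ≠ o} := by
    intro ω hω
    by_cases h0 : X 0 ω = o
    · left
      refine ⟨fun j hj => ?_, fun i hi => by simpa using hω i hi⟩
      obtain rfl : j = 0 := by omega
      exact h0
    · right; exact h0
  refine (measure_mono hsub).trans ((measure_union_le _ _).trans ?_)
  rw [ae_start G hX, add_zero]
  refine h.trans ?_
  calc _ ≤ 1 * ENNReal.ofReal (pathProb G A m o) := by gcongr; exact prob_le_one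
    _ = _ := one_mul _

lemma eventually_prob [IsProbabilityMeasure P] (D : ℕ → Set Ω) (E : Set Ω) (hE : P E = 1)
    (hED : ∀ ω ∈ E, ∀ᶠ n in Filter.atTop, ω ∈ D n) (η : ℝ) (hη : 0 < η) :
    ∀ᶠ n in Filter.atTop, ENNReal.ofReal (1 - η) < P (D n) := by
  let F : ℕ → Set Ω := fun N => {ω | ∀ n ≥ N, ω ∈ D n}
  have hF : Monotone F := fun a b hab ω hω n hn => hω n (hab.trans hn)
  have hsub : E ⊆ ⋃ N, F N := by
    intro ω hω
    obtain ⟨N, hN⟩ := Filter.eventually_atTop.mp (hED ω hω)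
    exact Set.mem_iUnion.mpr ⟨N, hN⟩
  have h1 : P (⋃ N, F N) = 1 := le_antisymm prob_le_one (hE ▸ measure_mono hsub)
  have h2 := tendsto_measure_iUnion_atTop (μ := P) hF
  rw [h1] at h2
  have h3 : ENNReal.ofReal (1 - η) < 1 := by
    rw [← ENNReal.ofReal_one]
    exact (ENNReal.ofReal_lt_ofReal_iff (by norm_num)).mpr (by linarith)
  filter_upwards [h2.eventually (lt_mem_nhds h3)] with n hn
  exact hn.trans_le (measure_mono fun ω hω => hω n le_rfl)

/-- the key tool: almost sure events give lower bounds on path probabilities -/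
lemma eventually_pathProb [Countable V] [IsProbabilityMeasure P] (hX : IsSRW G o P X)
    (m : ℕ → ℕ) (A : ℕ → ℕ → Set V) (E : Set Ω) (hE : P E = 1)
    (hED : ∀ ω ∈ E, X 0 ω = o → ∀ᶠ n in Filter.atTop, ∀ i ≤ m n, X i ω ∈ A n i)
    (η : ℝ) (hη : 0 < η) :
    ∀ᶠ n in Filter.atTop, 1 - η < pathProb G (A n) (m n) o := by
  have hE' : P (E ∩ {ω | X 0 ω = o}) = 1 := by
    refine le_antisymm prob_le_one ?_
    rw [← hE]
    have : E ⊆ (E ∩ {ω | X 0 ω = o}) ∪ {ω | X 0 ω ≠ o} := by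
      intro ω hω
      by_cases h : X 0 ω = o
      · exact Or.inl ⟨hω, h⟩
      · exact Or.inr h
    refine (measure_mono this).trans ((measure_union_le _ _).trans ?_)
    rw [ae_start G hX, add_zero]
  filter_upwards [eventually_prob (fun n => {ω | ∀ i ≤ m n, X i ω ∈ A n i}) _ hE'
    (fun ω hω => hED ω hω.1 hω.2) η hη] with n hn
  have := hn.trans_le (prob_le_pathProb G hX (m n) (A n))
  exact (ENNReal.ofReal_lt_ofReal_iff').mp this |>.1

end prob

lemma lin_bound (a : ℕ → ℝ) (c c' : ℝ) (h : Filter.Tendsto (fun t : ℕ => a t / t)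
    Filter.atTop (nhds c)) (hc : c < c') : ∃ M : ℝ, 0 ≤ M ∧ ∀ j : ℕ, a j ≤ M + c' * j := by
  obtain ⟨N, hN⟩ := Filter.eventually_atTop.mp
    ((h.eventually (gt_mem_nhds hc)).and (Filter.eventually_gt_atTop 0))
  refine ⟨∑ j ∈ Finset.range N, |a j - c' * j|, Finset.sum_nonneg fun _ _ => abs_nonneg _, ?_⟩
  intro j
  rcases Nat.lt_or_ge j N with hj | hj
  · have := Finset.single_le_sum (f := fun j : ℕ => |a j - c' * j|)
      (fun i _ => abs_nonneg _) (Finset.mem_range.mpr hj)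
    have h2 := le_abs_self (a j - c' * j)
    linarith
  · obtain ⟨h1, h2⟩ := hN j hj
    have h3 : (0 : ℝ) < j := by exact_mod_cast h2
    rw [div_lt_iff₀ h3] at h1
    have : 0 ≤ ∑ j ∈ Finset.range N, |a j - c' * j| := Finset.sum_nonneg fun _ _ => abs_nonneg _
    linarith

/-- one step distribution -/
def step (x : V) : V →₀ ℝ := ∑ z ∈ G.neighborFinset x, Finsupp.single z ((G.degree x : ℝ))⁻¹

/-- push a finitely supported mass distribution one step forward -/
def push : (V →₀ ℝ) →ₗ[ℝ] (V →₀ ℝ) := Finsupp.linearCombination ℝ (step G)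

/-- integrate a function against a finitely supported mass -/
def pair (f : V → ℝ) : (V →₀ ℝ) →ₗ[ℝ] ℝ := Finsupp.linearCombination ℝ f

lemma pair_single (f : V → ℝ) (x : V) (m : ℝ) : pair f (Finsupp.single x m) = m * f x := by
  simp [pair]

lemma pair_eq (f : V → ℝ) (ν : V →₀ ℝ) : pair f ν = ∑ x ∈ ν.support, ν x * f x := by
  simp [pair, Finsupp.linearCombination_apply, Finsupp.sum]

lemma pair_mono {f g : V → ℝ} (ν : V →₀ ℝ) (hν : ∀ x, 0 ≤ ν x) (h : ∀ x, f x ≤ g x) :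
    pair f ν ≤ pair g ν := by
  rw [pair_eq, pair_eq]
  exact Finset.sum_le_sum fun x _ => mul_le_mul_of_nonneg_left (h x) (hν x)

lemma pair_step (f : V → ℝ) (x : V) : pair f (step G x) = avg G f x := by
  simp [step, pair_single, avg]

lemma pair_push (f : V → ℝ) (ν : V →₀ ℝ) : pair f (push G ν) = pair (avg G f) ν := by
  have : (pair f).comp (push G) = pair (avg G f) := by
    ext x
    simp [push, pair_step, pair_single]
  exact LinearMap.congr_fun this ν

lemma step_apply (x u : V) : step G x u = if G.Adj x u then ((G.degree x : ℝ))⁻¹ else 0 := by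
  simp [step, Finsupp.finsetSum_apply, Finsupp.single_apply]

lemma step_nonneg (x u : V) : 0 ≤ step G x u := by
  rw [step_apply]; split_ifs
  · positivity
  · rfl

lemma push_single (x : V) (m : ℝ) : push G (Finsupp.single x m) = m • step G x := by
  simp [push]

lemma pair_ind (x : V) (ν : V →₀ ℝ) : pair (fun y => if y = x then 1 else 0) ν = ν x := by
  rw [pair_eq]
  simp only [mul_ite, mul_one, mul_zero, Finset.sum_ite_eq']
  by_cases h : x ∈ ν.support
  · simp [h]
  · simp only [h, if_false]
    rw [Finsupp.notMem_support_iff] at h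
    exact h.symm

lemma push_nonneg (ν : V →₀ ℝ) (hν : ∀ x, 0 ≤ ν x) (x : V) : 0 ≤ push G ν x := by
  rw [← pair_ind, pair_push]
  have := pair_mono (f := fun _ => 0) (g := avg G (fun y => if y = x then 1 else 0)) ν hν
    (avg_nonneg G (fun y => by split_ifs <;> norm_num))
  refine le_trans (le_of_eq ?_) this
  rw [pair_eq]; simp

lemma topple_coe (ν : V →₀ ℝ) (v : V) (m : ℝ) :
    topple G (⇑ν) v m = ⇑(ν + m • step G v - Finsupp.single v m) := by
  ext u
  simp only [topple, Finsupp.coe_sub, Finsupp.coe_add, Finsupp.coe_smul, Pi.sub_apply,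
    Pi.add_apply, Pi.smul_apply, step_apply, Finsupp.single_apply, smul_eq_mul, mul_ite, mul_zero,
    div_eq_mul_inv, eq_comm (a := v) (b := u)]
  ring

lemma pointMass_coe (o : V) : pointMass o = ⇑(Finsupp.single o (1 : ℝ)) := by
  ext u
  simp [pointMass, Finsupp.single_apply, eq_comm]

lemma tsum_compl (B : Set V) (ν : V →₀ ℝ) :
    ∑' v : {v : V // v ∉ B}, ν v = pair (fun x => if x ∈ B then 0 else 1) ν := by
  rw [pair_eq]
  have h1 : ∑' v : {v : V // v ∉ B}, ν v = ∑' v, (Bᶜ : Set V).indicator ν v :=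
    tsum_subtype (Bᶜ : Set V) ν
  rw [h1, tsum_eq_sum (s := ν.support)]
  · refine Finset.sum_congr rfl fun x _ => ?_
    by_cases h : x ∈ B <;> simp [h]
  · intro x hx
    rw [Finsupp.notMem_support_iff] at hx
    by_cases h : x ∈ B <;> simp [h, hx]

/-- supersolution used for the lower bound -/
def gfun (B : Set V) (S : Finset V) : ℕ → V → ℝ
  | 0 => fun x => if x ∈ B then (if x ∈ S then 1 else 0) else 1
  | (m + 1) => fun x => if x ∈ B then (if x ∈ S then avg G (gfun B S m) x else 0) else 1

lemma gfun_le_one (B : Set V) (S : Finset V) (m : ℕ) (x : V) : gfun G B S m x ≤ 1 := by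
  induction m generalizing x with
  | zero => simp only [gfun]; split_ifs <;> norm_num
  | succ m ih =>
    simp only [gfun]; split_ifs
    · exact avg_le_one G ih x
    · norm_num
    · norm_num

lemma gfun_nonneg (B : Set V) (S : Finset V) (m : ℕ) (x : V) : 0 ≤ gfun G B S m x := by
  induction m generalizing x with
  | zero => simp only [gfun]; split_ifs <;> norm_num
  | succ m ih =>
    simp only [gfun]; split_ifs
    · exact avg_nonneg G ih x
    · norm_num
    · norm_num

lemma gfun_anti (B : Set V) (S : Finset V) (m : ℕ) (x : V) :
    gfun G B S (m + 1) x ≤ gfun G B S m x := by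
  induction m generalizing x with
  | zero =>
    simp only [gfun]; split_ifs
    · exact avg_le_one G (gfun_le_one G B S 0) x
    · norm_num
    · norm_num
  | succ m ih =>
    rw [gfun, gfun]
    simp only
    split_ifs
    · exact avg_mono G ih x
    · norm_num
    · norm_num

lemma gfun_super (B : Set V) (S : Finset V) (m : ℕ) (x : V) (hx : x ∈ S) :
    avg G (gfun G B S m) x ≤ gfun G B S m x := by
  by_cases h : x ∈ B
  · have := gfun_anti G B S m x
    rw [gfun] at this
    simpa [h, hx] using this
  · refine (avg_le_one G (gfun_le_one G B S m) x).trans (le_of_eq ?_)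
    cases m <;> simp [gfun, h]

lemma gfun_bound (hd : ∀ x, 0 < G.degree x) (B : Set V) (S : Finset V) (m : ℕ) (x : V) :
    gfun G B S m x + pathProb G (fun _ => B) m x ≤ 1 + ∑ y ∈ S, rwKernel G m x y := by
  induction m generalizing x with
  | zero =>
    simp only [gfun, pathProb, rwKernel, Finset.sum_ite_eq]
    by_cases h : x ∈ B <;> by_cases h2 : x ∈ S <;> simp [h, h2]
  | succ m ih =>
    have hs : 0 ≤ ∑ y ∈ S, rwKernel G (m + 1) x y := Finset.sum_nonneg fun y _ => rw_nonneg G _ _ _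
    have hpp := pathProb_le_one G (fun _ => B) (m + 1) x
    by_cases h : x ∈ B
    · by_cases h2 : x ∈ S
      · have e : avg G (fun y => ∑ i ∈ S, rwKernel G m y i) x =
            ∑ y ∈ S, rwKernel G (m+1) x y := by
          simp only [avg, rwKernel, Finset.mul_sum]
          exact Finset.sum_comm
        have := avg_mono G ih x
        rw [avg_add, avg_add, avg_one G hd, e] at this
        simp only [gfun, pathProb, h, h2, if_true]
        exact this
      · simp only [gfun, h, h2, if_true, if_false]
        linarith
    · simp only [gfun, pathProb, h, if_false]
      linarith

lemma lower_det (B : Set V) (p : ℝ) (o : V) (t : ℕ)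
    (h : CanTransport G B p (pointMass o) t) :
    ∃ S : Finset V, S.card ≤ t ∧ ∀ m, p ≤ gfun G B S m o := by
  obtain ⟨μ₁, ⟨μs, h0, ht, hs⟩, hp⟩ := h
  have : Nonempty V := ⟨o⟩
  choose! v m hm using hs
  refine ⟨(Finset.range t).image v, Finset.card_image_le.trans (by simp), fun k => ?_⟩
  set S := (Finset.range t).image v with hS
  have key : ∀ i ≤ t, ∃ ν : V →₀ ℝ, ⇑ν = μs i ∧ (∀ x, 0 ≤ ν x) ∧
      pair (gfun G B S k) ν ≤ gfun G B S k o := by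
    intro i
    induction i with
    | zero =>
      intro _
      refine ⟨Finsupp.single o 1, ?_, ?_, ?_⟩
      · rw [h0, pointMass_coe]
      · intro x; rw [Finsupp.single_apply]; split_ifs <;> norm_num
      · rw [pair_single, one_mul]
    | succ i ih =>
      intro hi
      obtain ⟨ν, h1, h2, h3⟩ := ih (by omega)
      obtain ⟨m0, m1, m2⟩ := hm i (by omega)
      rw [← h1] at m1 m2
      refine ⟨ν + m i • step G (v i) - Finsupp.single (v i) (m i), ?_, ?_, ?_⟩
      · rw [m2, topple_coe]
      · intro x
        have := step_nonneg G (v i) x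
        have h4 : 0 ≤ m i * step G (v i) x := by positivity
        simp only [Finsupp.coe_sub, Finsupp.coe_add, Finsupp.coe_smul, Pi.sub_apply, Pi.add_apply,
          Pi.smul_apply, smul_eq_mul, Finsupp.single_apply]
        split_ifs with h5
        · subst h5; linarith
        · linarith [h2 x]
      · rw [map_sub, map_add, map_smul, pair_step, pair_single, smul_eq_mul]
        have := gfun_super G B S k (v i) (Finset.mem_image_of_mem v (Finset.mem_range.mpr (by omega)))
        nlinarith
  obtain ⟨ν, h1, h2, h3⟩ := key t le_rfl
  rw [ht] at h1
  subst h1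
  rw [tsum_compl] at hp
  refine hp.trans (le_trans (pair_mono ν h2 fun x => ?_) h3)
  split_ifs with hx
  · exact gfun_nonneg G B S k x
  · cases k <;> simp [gfun, hx]

lemma toppleSeq_snoc {μ₀ μ₁ : V → ℝ} {t : ℕ} (h : ToppleSeq G μ₀ t μ₁) (v : V) (m : ℝ)
    (hm : 0 < m) (hm' : m ≤ μ₁ v) : ToppleSeq G μ₀ (t + 1) (topple G μ₁ v m) := by
  obtain ⟨μs, h0, ht, hs⟩ := h
  refine ⟨Function.update μs (t + 1) (topple G μ₁ v m), ?_, ?_, ?_⟩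
  · rw [Function.update_of_ne (by omega), h0]
  · simp
  · intro i hi
    rcases Nat.lt_or_ge i t with h1 | h1
    · rw [Function.update_of_ne (by omega), Function.update_of_ne (by omega)]
      exact hs i h1
    · obtain rfl : i = t := by omega
      refine ⟨v, m, hm, ?_, ?_⟩
      · rw [Function.update_of_ne (by omega), ht]; exact hm'
      · rw [Function.update_self, Function.update_of_ne (by omega), ht]

lemma toppleSeq_push {μ₀ : V → ℝ} (κ : V →₀ ℝ) : ∀ (r : V →₀ ℝ) (t : ℕ), (∀ x, 0 ≤ κ x) →
    (∀ x, 0 ≤ r x) → ToppleSeq G μ₀ t ⇑(κ + r) →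
    ToppleSeq G μ₀ (t + κ.support.card) ⇑(push G κ + r) := by
  induction κ using Finsupp.induction with
  | zero => intro r t _ _ h; simpa using h
  | single_add a b f ha hb ih =>
    intro r t hκ hr h
    have hfa : f a = 0 := Finsupp.notMem_support_iff.mp ha
    have hb0 : 0 < b := by
      have := hκ a
      simp only [Finsupp.coe_add, Pi.add_apply, Finsupp.single_eq_same, hfa, add_zero] at this
      exact lt_of_le_of_ne this (Ne.symm hb)
    have hf : ∀ x, 0 ≤ f x := by
      intro x
      by_cases hx : x = a
      · rw [hx, hfa]
      · have := hκ x
        simpa [Finsupp.single_apply, Ne.symm hx] using this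
    have h2 := toppleSeq_snoc G h a b hb0 (by
      simp only [Finsupp.coe_add, Pi.add_apply, Finsupp.single_eq_same, hfa, add_zero]
      linarith [hr a])
    rw [topple_coe, show Finsupp.single a b + f + r + b • step G a - Finsupp.single a b =
      f + (r + b • step G a) by abel] at h2
    have h3 := ih (r + b • step G a) (t + 1) hf (by
      intro x
      have := step_nonneg G a x
      have := hr x
      simp only [Finsupp.coe_add, Finsupp.coe_smul, Pi.add_apply, Pi.smul_apply, smul_eq_mul]
      positivity) h2
    have hc : (Finsupp.single a b + f).support.card = f.support.card + 1 := by
      rw [Finsupp.support_single_add ha hb, Finset.card_cons]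
    rw [hc, map_add, push_single]
    convert h3 using 1
    · ring
    · congr 1; abel

lemma pair_filter (f : V → ℝ) (A : Set V) (ν : V →₀ ℝ) :
    pair f (ν.filter (· ∈ A)) = pair (fun x => if x ∈ A then f x else 0) ν := by
  induction ν using Finsupp.induction_linear with
  | zero => rw [Finsupp.filter_zero, map_zero, map_zero]
  | add a b ha hb => rw [Finsupp.filter_add, map_add, map_add, ha, hb]
  | single a b =>
    rw [pair_single]
    by_cases h : a ∈ A
    · rw [Finsupp.filter_single_of_pos _ h, pair_single]; simp [h]
    · rw [Finsupp.filter_single_of_neg _ h]; simp [h]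

lemma iter_ind (j : ℕ) (x y : V) :
    (avg G)^[j] (fun z => if z = y then 1 else 0) x = rwKernel G j x y := by
  induction j generalizing x with
  | zero => simp [rwKernel]
  | succ j ih =>
    rw [Function.iterate_succ_apply']
    simp only [avg, rwKernel, ih]

lemma upper_det (o : V) (A : ℕ → Set V) (s : ℕ) (c : ℝ)
    (hA : ∀ j < s, ∀ x ∈ A j, - Real.log (rwKernel G j o x) ≤ c) :
    ∀ j ≤ s, ∃ (t : ℕ) (ν r : V →₀ ℝ), (t : ℝ) ≤ j * Real.exp c ∧ (∀ x, 0 ≤ ν x) ∧ (∀ x, 0 ≤ r x) ∧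
      ToppleSeq G (pointMass o) t ⇑(ν + r) ∧
      (∀ f : V → ℝ, (∀ x, 0 ≤ f x) → pair f ν ≤ (avg G)^[j] f o) ∧
      (∀ m, pair (pathProb G (fun i => A (j + i)) m) ν = pathProb G A (j + m) o) := by
  intro j
  induction j with
  | zero =>
    intro _
    refine ⟨0, Finsupp.single o 1, 0, by simp, ?_, by simp, ?_, ?_, ?_⟩
    · intro x; rw [Finsupp.single_apply]; split_ifs <;> norm_num
    · rw [pointMass_coe, add_zero]
      exact ⟨fun _ => ⇑(Finsupp.single o (1 : ℝ)), rfl, rfl, by simp⟩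
    · intro f _
      rw [pair_single]; simp
    · intro m
      rw [pair_single]; simp
  | succ j ih =>
    intro hj
    obtain ⟨t, ν, r, h1, h2, h3, h4, h5, h6⟩ := ih (by omega)
    set κ := ν.filter (· ∈ A j) with hκ
    set ρ := ν.filter (fun x => ¬ (x ∈ A j)) with hρ
    have hκ0 : ∀ x, 0 ≤ κ x := by
      intro x; rw [hκ, Finsupp.filter_apply]; split_ifs
      · exact h2 x
      · rfl
    have hρ0 : ∀ x, 0 ≤ ρ x := by
      intro x; rw [hρ, Finsupp.filter_apply]; split_ifs
      · rfl
      · exact h2 x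
    have hsum : κ + ρ = ν := Finsupp.filter_add_filter_not ν _
    have hr0 : ∀ x, 0 ≤ (ρ + r) x := fun x => add_nonneg (hρ0 x) (h3 x)
    have hcard : (κ.support.card : ℝ) ≤ Real.exp c := by
      have hx : ∀ x ∈ κ.support, Real.exp (-c) ≤ rwKernel G j o x := by
        intro x hx
        rw [hκ, Finsupp.support_filter, Finset.mem_filter, Finsupp.mem_support_iff] at hx
        have hpos : 0 < ν x := lt_of_le_of_ne (h2 x) (Ne.symm hx.1)
        have h7 := h5 (fun z => if z = x then 1 else 0) (fun z => by split_ifs <;> norm_num)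
        rw [pair_ind, iter_ind] at h7
        rw [← Real.le_log_iff_exp_le (hpos.trans_le h7)]
        linarith [hA j (by omega) x hx.2]
      have h8 := (Finset.sum_le_sum hx).trans (sum_rw_le_one G j o κ.support)
      rw [Finset.sum_const, nsmul_eq_mul, Real.exp_neg, ← div_eq_mul_inv,
        div_le_one (Real.exp_pos c)] at h8
      exact h8
    refine ⟨t + κ.support.card, push G κ, ρ + r, ?_, push_nonneg G κ hκ0, hr0, ?_, ?_, ?_⟩
    · push_cast; linarith
    · refine toppleSeq_push G κ (ρ + r) t hκ0 hr0 ?_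
      rwa [← add_assoc, hsum]
    · intro f hf
      rw [pair_push, hκ, pair_filter, Function.iterate_succ_apply]
      refine le_trans (pair_mono ν h2 fun x => ?_) (h5 (avg G f) (avg_nonneg G hf))
      split_ifs
      · rfl
      · exact avg_nonneg G hf x
    · intro m
      rw [pair_push, hκ, pair_filter]
      have := h6 (m + 1)
      rw [show j + 1 + m = j + (m + 1) by ring, ← this]
      congr 1
      simp only [pathProb, add_zero]
      simp only [show ∀ i, j + 1 + i = j + (i + 1) from fun i => by ring]

lemma upper_transport (o : V) (A : ℕ → Set V) (B : Set V) (s : ℕ) (c p : ℝ)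
    (hA : ∀ j < s, ∀ x ∈ A j, - Real.log (rwKernel G j o x) ≤ c)
    (hB : ∀ x ∈ A s, x ∉ B) (hp : p ≤ pathProb G A s o) :
    ∃ t : ℕ, CanTransport G B p (pointMass o) t ∧ (t : ℝ) ≤ s * Real.exp c := by
  obtain ⟨t, ν, r, h1, h2, h3, h4, _, h6⟩ := upper_det G o A s c hA s le_rfl
  refine ⟨t, ⟨_, h4, ?_⟩, h1⟩
  rw [tsum_compl, map_add]
  have hr : 0 ≤ pair (fun x => if x ∈ B then (0 : ℝ) else 1) r := by
    rw [pair_eq]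
    refine Finset.sum_nonneg fun x _ => mul_nonneg (h3 x) ?_
    split_ifs <;> norm_num
  have h7 := h6 0
  rw [add_zero] at h7
  rw [← h7] at hp
  have h8 : pair (pathProb G (fun i => A (s + i)) 0) ν ≤
      pair (fun x => if x ∈ B then (0 : ℝ) else 1) ν := by
    refine pair_mono ν h2 fun x => ?_
    simp only [pathProb, add_zero]
    by_cases hx : x ∈ A s
    · simp [hx, hB x hx]
    · simp only [hx, if_false]; split_ifs <;> norm_num
  linarith

lemma lower_transport (hd : ∀ x, 0 < G.degree x) (o : V) (B : Set V) (p : ℝ) (t s : ℕ) (c : ℝ)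
    (h : CanTransport G B p (pointMass o) t)
    (h1 : 1 - p / 4 < pathProb G (fun _ => B) s o)
    (h2 : 1 - p / 4 < pathProb G
      (fun i => if i = s then {x | Real.log (rwKernel G s o x) ≤ - c} else Set.univ) s o) :
    p / 2 * Real.exp c ≤ t := by
  obtain ⟨S, hS, hg⟩ := lower_det G B p o t h
  have hb := gfun_bound G hd B S s o
  have hgs := hg s
  set F := S.filter (fun x => Real.log (rwKernel G s o x) ≤ - c)
  set F' := S.filter (fun x => ¬ (Real.log (rwKernel G s o x) ≤ - c))
  have hsplit : ∑ y ∈ F, rwKernel G s o y + ∑ y ∈ F', rwKernel G s o y =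
      ∑ y ∈ S, rwKernel G s o y := Finset.sum_filter_add_sum_filter_not _ _ _
  have hF' := pathProb_add_sum G
    (fun i => if i = s then {x | Real.log (rwKernel G s o x) ≤ - c} else Set.univ) s o F' (by
      intro y hy
      simpa using (Finset.mem_filter.mp hy).2)
  have hF : ∑ y ∈ F, rwKernel G s o y ≤ t * Real.exp (-c) := by
    have : ∀ y ∈ F, rwKernel G s o y ≤ Real.exp (-c) := by
      intro y hy
      have hy := (Finset.mem_filter.mp hy).2
      rcases (rw_nonneg G s o y).eq_or_lt with h0 | h0
      · rw [← h0]; positivity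
      · exact (Real.log_le_iff_le_exp h0).mp hy
    refine (Finset.sum_le_sum this).trans ?_
    rw [Finset.sum_const, nsmul_eq_mul]
    gcongr
    exact (Finset.card_filter_le _ _).trans hS
  have : p / 2 ≤ t * Real.exp (-c) := by linarith
  rw [Real.exp_neg, ← div_eq_mul_inv, le_div_iff₀ (Real.exp_pos c)] at this
  exact this


open Filter in
lemma upper_main [Countable V] (hd : ∀ x, 0 < G.degree x) (o : V)
    {Ω : Type*} [MeasurableSpace Ω] (P : MeasureTheory.Measure Ω)
    [MeasureTheory.IsProbabilityMeasure P] (X : ℕ → Ω → V) (hX : IsSRW G o P X)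
    (l h : ℝ) (hl : 0 < l) (hh : 0 < h)
    (hspeed : P {ω | Filter.Tendsto
        (fun t : ℕ => (G.dist (X 0 ω) (X t ω) : ℝ) / t) Filter.atTop (nhds l)} = 1)
    (hshannon : P {ω | Filter.Tendsto
        (fun t : ℕ => Real.log (rwKernel G t o (X t ω)) / t) Filter.atTop (nhds (-h))} = 1)
    (p : ℝ) (hp1 : p < 1) (ε : ℝ) (hε : 0 < ε) :
    ∀ᶠ n : ℕ in atTop, ∃ t : ℕ, CanTransport G (gball G o n) p (pointMass o) t ∧
        (t : ℝ) ≤ Real.exp ((n : ℝ) * (h / l) * (1 + ε)) := by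
  obtain ⟨θ, hθ, hθ1, hθε⟩ : ∃ θ : ℝ, 0 < θ ∧ θ ≤ 1 ∧ 7 * θ ≤ ε := by
    refine ⟨min 1 (ε / 7), lt_min one_pos (by positivity), min_le_left _ _, ?_⟩
    have := min_le_right 1 (ε / 7)
    linarith
  let s : ℕ → ℕ := fun n => ⌈(n : ℝ) * (1 + θ) / l⌉₊
  have hs1 : ∀ n : ℕ, (n : ℝ) * (1 + θ) / l ≤ s n := fun n => Nat.le_ceil _
  have hs2 : ∀ n : ℕ, (s n : ℝ) < (n : ℝ) * (1 + θ) / l + 1 := fun n =>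
    Nat.ceil_lt_add_one (by positivity)
  have hsR : Tendsto (fun n => (s n : ℝ)) atTop atTop := by
    refine tendsto_atTop_mono hs1 ?_
    have : Tendsto (fun n : ℕ => (n : ℝ) * ((1 + θ) / l)) atTop atTop :=
      tendsto_natCast_atTop_atTop.atTop_mul_const (by positivity)
    simpa [mul_div_assoc] using this
  have hsN : Tendsto s atTop atTop := tendsto_natCast_atTop_iff.mp hsR
  let A : ℕ → ℕ → Set V := fun n j =>
    {x | - Real.log (rwKernel G j o x) ≤ h * (1 + θ / 2) * s n}
  let C : ℕ → ℕ → Set V := fun n j => if j = s n then (gball G o n)ᶜ else Set.univ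
  have hA := eventually_pathProb G hX s A _ hshannon (by
    intro ω hω _
    have h1 : Tendsto (fun t : ℕ => - Real.log (rwKernel G t o (X t ω)) / t) atTop (nhds h) := by
      have := Tendsto.neg hω
      simpa [neg_div] using this
    obtain ⟨M, hM, hb⟩ := lin_bound _ h (h * (1 + θ / 4)) h1 (by nlinarith)
    filter_upwards [hsR.eventually_ge_atTop (M / (h * θ / 4))] with n hn i hi
    rw [div_le_iff₀ (by positivity)] at hn
    have h2 := hb i
    have h3 : (i : ℝ) ≤ s n := by exact_mod_cast hi
    have h4 : h * (1 + θ / 4) * i ≤ h * (1 + θ / 4) * s n := by gcongr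
    change - Real.log (rwKernel G i o (X i ω)) ≤ h * (1 + θ / 2) * s n
    linarith) ((1 - p) / 2) (by linarith)
  have hC := eventually_pathProb G hX s C _ hspeed (by
    intro ω hω h0
    have h1 : ∀ᶠ t : ℕ in atTop, l / (1 + θ) < (G.dist (X 0 ω) (X t ω) : ℝ) / t :=
      hω.eventually (lt_mem_nhds (by rw [div_lt_iff₀ (by positivity)]; nlinarith))
    filter_upwards [hsN.eventually (h1.and (eventually_gt_atTop 0))] with n hn i hi
    by_cases his : i = s n
    · subst his
      obtain ⟨h2, h3⟩ := hn
      have h3' : (0 : ℝ) < s n := by exact_mod_cast h3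
      rw [lt_div_iff₀ h3', div_mul_eq_mul_div, div_lt_iff₀ (by positivity), h0] at h2
      have h4 := hs1 n
      rw [div_le_iff₀ hl] at h4
      have h5 : (n : ℝ) ≤ G.dist o (X (s n) ω) := by
        have : (n : ℝ) * (1 + θ) ≤ G.dist o (X (s n) ω) * (1 + θ) := by linarith
        exact le_of_mul_le_mul_right this (by positivity)
      have h6 : n ≤ G.dist o (X (s n) ω) := by exact_mod_cast h5
      simp only [C, if_true]
      intro h7
      exact absurd h7 (not_lt.mpr h6)
    · simp [C, his]) ((1 - p) / 2) (by linarith)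
  have hexp : ∀ᶠ x : ℝ in atTop, x ≤ Real.exp (h * (θ / 2) * x) := by
    have h1 := (isLittleO_pow_exp_pos_mul_atTop 1 (b := h * (θ / 2)) (by positivity)).bound
      (c := 1) one_pos
    filter_upwards [h1, eventually_ge_atTop 0] with x hx hx0
    rw [pow_one, one_mul, Real.norm_of_nonneg hx0, Real.norm_of_nonneg (Real.exp_pos _).le] at hx
    exact hx
  have hn0 : ∀ᶠ n : ℕ in atTop, 1 ≤ (n : ℝ) * (θ * (1 + θ) / l) :=
    (tendsto_natCast_atTop_atTop.atTop_mul_const (by positivity)).eventually_ge_atTop 1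
  filter_upwards [hA, hC, hsR.eventually hexp, hn0] with n hA hC hexp hn0
  have hAC := pathProb_inter G hd (A n) (C n) (s n) o
  obtain ⟨t, ht, ht2⟩ := upper_transport G o (fun i => A n i ∩ C n i) (gball G o n) (s n)
    (h * (1 + θ / 2) * s n) p (fun j _ x hx => hx.1) (fun x hx => by
      have := hx.2
      simpa [C] using this) (by linarith)
  refine ⟨t, ht, ht2.trans ?_⟩
  calc (s n : ℝ) * Real.exp (h * (1 + θ / 2) * s n)
      ≤ Real.exp (h * (θ / 2) * s n) * Real.exp (h * (1 + θ / 2) * s n) := by gcongr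
    _ = Real.exp (h * (1 + θ) * s n) := by rw [← Real.exp_add]; congr 1; ring
    _ ≤ _ := by
      apply Real.exp_le_exp.mpr
      have h1 : (s n : ℝ) ≤ n * (1 + θ) ^ 2 / l := by
        have := hs2 n
        have e : (n : ℝ) * (1 + θ) ^ 2 / l = n * (1 + θ) / l + n * (θ * (1 + θ) / l) := by ring
        linarith
      have h2 : (1 + θ) ^ 3 ≤ 1 + ε := by nlinarith [sq_nonneg θ, mul_pos hθ hθ]
      calc h * (1 + θ) * s n ≤ h * (1 + θ) * (n * (1 + θ) ^ 2 / l) := by gcongr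
        _ = n * (h / l) * (1 + θ) ^ 3 := by ring
        _ ≤ _ := by gcongr

open Filter in
lemma lower_main [Countable V] (hd : ∀ x, 0 < G.degree x) (o : V)
    {Ω : Type*} [MeasurableSpace Ω] (P : MeasureTheory.Measure Ω)
    [MeasureTheory.IsProbabilityMeasure P] (X : ℕ → Ω → V) (hX : IsSRW G o P X)
    (l h : ℝ) (hl : 0 < l) (hh : 0 < h)
    (hspeed : P {ω | Filter.Tendsto
        (fun t : ℕ => (G.dist (X 0 ω) (X t ω) : ℝ) / t) Filter.atTop (nhds l)} = 1)
    (hshannon : P {ω | Filter.Tendsto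
        (fun t : ℕ => Real.log (rwKernel G t o (X t ω)) / t) Filter.atTop (nhds (-h))} = 1)
    (p : ℝ) (hp0 : 0 < p) (ε : ℝ) (hε : 0 < ε) :
    ∀ᶠ n : ℕ in atTop, ∀ t : ℕ, CanTransport G (gball G o n) p (pointMass o) t →
        Real.exp ((n : ℝ) * (h / l) * (1 - ε)) ≤ (t : ℝ) := by
  obtain ⟨θ, hθ, hθ1, hθε⟩ : ∃ θ : ℝ, 0 < θ ∧ θ ≤ 1 / 2 ∧ 4 * θ ≤ ε := by
    refine ⟨min (1 / 2) (ε / 4), lt_min (by norm_num) (by positivity), min_le_left _ _, ?_⟩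
    have := min_le_right (1 / 2) (ε / 4)
    linarith
  have hθ2 : 0 < 1 - θ := by linarith
  let s : ℕ → ℕ := fun n => ⌊(n : ℝ) * (1 - θ) / l⌋₊
  have hs1 : ∀ n : ℕ, (s n : ℝ) ≤ (n : ℝ) * (1 - θ) / l := fun n => Nat.floor_le (by positivity)
  have hs2 : ∀ n : ℕ, (n : ℝ) * (1 - θ) / l - 1 ≤ s n := fun n =>
    (Nat.sub_one_lt_floor _).le
  have hsR : Tendsto (fun n => (s n : ℝ)) atTop atTop := by
    refine tendsto_atTop_mono hs2 ?_
    have : Tendsto (fun n : ℕ => (n : ℝ) * ((1 - θ) / l) - 1) atTop atTop :=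
      tendsto_atTop_add_const_right _ _
        (tendsto_natCast_atTop_atTop.atTop_mul_const (by positivity))
    simpa [mul_div_assoc] using this
  have hsN : Tendsto s atTop atTop := tendsto_natCast_atTop_iff.mp hsR
  have hA := eventually_pathProb G hX s (fun n _ => gball G o n) _ hspeed (by
    intro ω hω h0
    obtain ⟨M, hM, hb⟩ := lin_bound _ l (l * (1 + θ)) hω (by nlinarith)
    have hn0 : ∀ᶠ n : ℕ in atTop, M + 1 ≤ (n : ℝ) * θ ^ 2 :=
      (tendsto_natCast_atTop_atTop.atTop_mul_const (by positivity)).eventually_ge_atTop _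
    filter_upwards [hn0] with n hn i hi
    have h2 := hb i
    rw [h0] at h2
    have h3 : (i : ℝ) ≤ n * (1 - θ) / l := le_trans (by exact_mod_cast hi) (hs1 n)
    have h4 : l * (1 + θ) * i ≤ l * (1 + θ) * (n * (1 - θ) / l) := by gcongr
    have e : l * (1 + θ) * (n * (1 - θ) / l) = n - n * θ ^ 2 := by field_simp; ring
    have h5 : (G.dist o (X i ω) : ℝ) < n := by linarith
    change G.dist o (X i ω) < n
    exact_mod_cast h5) (p / 4) (by linarith)
  have hC := eventually_pathProb G hX s (fun n i => if i = s n then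
      {x | Real.log (rwKernel G (s n) o x) ≤ - (h * (1 - θ) * s n)} else Set.univ) _ hshannon (by
    intro ω hω _
    have h1 : ∀ᶠ t : ℕ in atTop, Real.log (rwKernel G t o (X t ω)) / t < -(h * (1 - θ)) :=
      hω.eventually (gt_mem_nhds (by nlinarith))
    filter_upwards [hsN.eventually (h1.and (eventually_gt_atTop 0))] with n hn i hi
    by_cases his : i = s n
    · subst his
      obtain ⟨h2, h3⟩ := hn
      have h3' : (0 : ℝ) < s n := by exact_mod_cast h3
      rw [div_lt_iff₀ h3'] at h2
      simp only [if_true]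
      change Real.log (rwKernel G (s n) o (X (s n) ω)) ≤ - (h * (1 - θ) * s n)
      linarith
    · simp [his]) (p / 4) (by linarith)
  have hn0 : ∀ᶠ n : ℕ in atTop, h - Real.log (p / 2) ≤ (n : ℝ) * (h / l * (ε / 2)) :=
      (tendsto_natCast_atTop_atTop.atTop_mul_const (by positivity)).eventually_ge_atTop _
  filter_upwards [hA, hC, hn0] with n hA hC hn0 t ht
  refine le_trans ?_ (lower_transport G hd o (gball G o n) p t (s n) _ ht hA hC)
  rw [← Real.exp_log (show 0 < p / 2 by positivity), ← Real.exp_add]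
  apply Real.exp_le_exp.mpr
  have h1 : h * (1 - θ) * (n * (1 - θ) / l - 1) ≤ h * (1 - θ) * s n := by
    gcongr; exact hs2 n
  have e : h * (1 - θ) * (n * (1 - θ) / l - 1) =
    n * (h / l) * (1 - ε) + n * (h / l) * ((1 - θ) ^ 2 - 1 + ε) - h * (1 - θ) := by ring
  have h2 : n * (h / l) * (ε / 2) ≤ n * (h / l) * ((1 - θ) ^ 2 - 1 + ε) := by
    gcongr
    nlinarith
  nlinarith

end CD

/-- **Graphs where random walk has positive speed and entropy**
(Florescu–Peres–Rácz, Theorem 6.4). Let `G` be an infinite, connected, locally finite graph and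
let `X` be simple random walk on `G` started at `o` (realized on a probability space `(Ω, P)`).
Assume: (1) the walk has positive asymptotic speed `ℓ > 0` almost surely; (2) the walk has
positive Avez entropy `h > 0` (where `H(X_t)` is the Shannon entropy of the time-`t` distribution
`p_t(o, ·)`); (3) Shannon's theorem holds: `(1/t)·log p_t(o, X_t) → -h` almost surely. Then the
minimum number of toppling moves needed to transport mass `p ∈ (0,1)` to graph distance at least
`n` from `o`, starting from the unit point mass at `o`, is `exp(n·(h/ℓ)·(1+o(1)))`. -/
theorem controlled_diffusion_positive_speed_entropy {V : Type*} (G : SimpleGraph V)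
    [G.LocallyFinite] [Infinite V] (hconn : G.Connected) (o : V)
    {Ω : Type*} [MeasurableSpace Ω] (P : MeasureTheory.Measure Ω)
    [MeasureTheory.IsProbabilityMeasure P] (X : ℕ → Ω → V) (hX : IsSRW G o P X)
    (l h : ℝ) (hl : 0 < l) (hh : 0 < h)
    (hspeed : P {ω | Filter.Tendsto
        (fun t : ℕ => (G.dist (X 0 ω) (X t ω) : ℝ) / t) Filter.atTop (nhds l)} = 1)
    (hentropy : Filter.Tendsto
        (fun t : ℕ => (∑' x : V, Real.negMulLog (rwKernel G t o x)) / t)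
        Filter.atTop (nhds h))
    (hshannon : P {ω | Filter.Tendsto
        (fun t : ℕ => Real.log (rwKernel G t o (X t ω)) / t) Filter.atTop (nhds (-h))} = 1)
    (p : ℝ) (hp0 : 0 < p) (hp1 : p < 1) :
    ∀ ε : ℝ, 0 < ε → ∃ n₀ : ℕ, ∀ n : ℕ, n₀ ≤ n →
      (∀ t : ℕ, CanTransport G (gball G o n) p (pointMass o) t →
        Real.exp ((n : ℝ) * (h / l) * (1 - ε)) ≤ (t : ℝ)) ∧
      (∃ t : ℕ, CanTransport G (gball G o n) p (pointMass o) t ∧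
        (t : ℝ) ≤ Real.exp ((n : ℝ) * (h / l) * (1 + ε))) := by
  intro ε hε
  have : Countable V := CD.countable_of_connected G hconn o
  have hd : ∀ x, 0 < G.degree x := fun x => hconn.preconnected.degree_pos_of_nontrivial x
  exact Filter.eventually_atTop.mp
    ((CD.lower_main G hd o P X hX l h hl hh hspeed hshannon p hp0 ε hε).and
      (CD.upper_main G hd o P X hX l h hl hh hspeed hshannon p hp1 ε hε))

end
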